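/- arXiv:math/0508289 — 2 statements merged into one kernel-verified Lean document; each statement's English description precedes it below -/
import Mathlib

section
/- Fix n ≥ 2. Let K be the generator of the algebra 𝒦_p, with p(u) = −u^{n+1} + A_0 u^n + A_1 u^{n−1} + … + A_n. Then for any pair ξ, ζ ∈ 𝔷 such that ζξ = A_n = −p(0)·(−1) (i.e. ξζ equals the constant term p(0) of p), the element K(x) := Σ_{i=0}^{n−1} φ_i(ξ,x) K^{n−i} + (ζ − x⁻¹ φ_n(ξ,x))/(x − x⁻¹) of 𝒦_p(x) is a solution of the reflection equation with spectral parameter; moreover it is a principal solution (the coefficient of K^{n−1} in its expansion over the basis {1, K, …, K^{n−1}, K̃}, where K̃ = K^n − A_0 K^{n−1} − … − A_{n−1}, is non-zero when ξ ≠ 0, and the coefficient of K^n, namely φ_0 = 1, is non-zero). -/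
noncomputable section
namespace Baxterization
open scoped TensorProduct

/-! ## The affine Hecke algebra of rank one -/

variable (k : Type) [Field k]
variable (z : Type) [CommRing z] [Algebra k z]

/-- the two generators R and K -/
inductive G : Type | R | K

/-- The defining relations of the affine Hecke algebra of rank one:
the Hecke condition `R² = ωR + 1` and the reflection equation `RKRK = KRKR`. -/
inductive HRel (ω : z) : FreeAlgebra z G → FreeAlgebra z G → Prop
  | hecke : HRel ω (FreeAlgebra.ι z G.R * FreeAlgebra.ι z G.R)
      (ω • FreeAlgebra.ι z G.R + 1)
  | re : HRel ω (FreeAlgebra.ι z G.R * FreeAlgebra.ι z G.K * FreeAlgebra.ι z G.R *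
        FreeAlgebra.ι z G.K)
      (FreeAlgebra.ι z G.K * FreeAlgebra.ι z G.R * FreeAlgebra.ι z G.K * FreeAlgebra.ι z G.R)

/-- The affine Hecke algebra of rank one over 𝔷, with parameter ω: the quotient of the
free algebra 𝔷⟨R,K⟩ by the ideal of relations `R² = ωR + 1` and `RKRK = KRKR`. -/
def H (ω : z) : Type := RingQuot (HRel z ω)

variable (ω : z)

instance : Ring (H z ω) := inferInstanceAs (Ring (RingQuot (HRel z ω)))
instance : Algebra z (H z ω) := inferInstanceAs (Algebra z (RingQuot (HRel z ω)))
instance : Algebra k (H z ω) := inferInstanceAs (Algebra k (RingQuot (HRel z ω)))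
instance : IsScalarTower k z (H z ω) :=
  inferInstanceAs (IsScalarTower k z (RingQuot (HRel z ω)))

/-- the generator R of the affine Hecke algebra -/
def Rg : H z ω := RingQuot.mkAlgHom z (HRel z ω) (FreeAlgebra.ι z G.R)
/-- the generator K of the affine Hecke algebra -/
def Kg : H z ω := RingQuot.mkAlgHom z (HRel z ω) (FreeAlgebra.ι z G.K)
/-- Y = RKR -/
def Yg : H z ω := Rg z ω * Kg z ω * Rg z ω

/-- the elements e_{i;j} = KⁱRKʲ - KʲRKⁱ of the affine Hecke algebra -/
def eH (i j : ℕ) : H z ω :=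
  Kg z ω ^ i * Rg z ω * Kg z ω ^ j - Kg z ω ^ j * Rg z ω * Kg z ω ^ i

/-! ## The cyclotomic Hecke algebra -/

/-- the element p(K) of H, where p(u) = -u^(n+1) + A₀ uⁿ + A₁ u^(n-1) + ⋯ + Aₙ -/
def pKelt (n : ℕ) (A : ℕ → z) : H z ω :=
  - (Kg z ω) ^ (n + 1) + ∑ i ∈ Finset.range (n + 1), A i • (Kg z ω) ^ (n - i)

/-- relation generating the two-sided ideal (p(K)) of H -/
inductive CRel (n : ℕ) (A : ℕ → z) : H z ω → H z ω → Prop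
  | mk : CRel n A (pKelt z ω n A) 0

/-- The cyclotomic Hecke algebra H_p: the quotient of the affine Hecke algebra H by the
two-sided ideal generated by p(K), where p(u) = -u^(n+1) + A₀ uⁿ + ⋯ + Aₙ. -/
def Hp (n : ℕ) (A : ℕ → z) : Type := RingQuot (CRel z ω n A)

instance (n : ℕ) (A : ℕ → z) : Ring (Hp z ω n A) :=
  inferInstanceAs (Ring (RingQuot (CRel z ω n A)))
instance (n : ℕ) (A : ℕ → z) : Algebra z (Hp z ω n A) :=
  inferInstanceAs (Algebra z (RingQuot (CRel z ω n A)))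
instance (n : ℕ) (A : ℕ → z) : Algebra k (Hp z ω n A) :=
  inferInstanceAs (Algebra k (RingQuot (CRel z ω n A)))
instance (n : ℕ) (A : ℕ → z) : IsScalarTower k z (Hp z ω n A) :=
  inferInstanceAs (IsScalarTower k z (RingQuot (CRel z ω n A)))

/-- the image of R in the cyclotomic Hecke algebra -/
def Rp (n : ℕ) (A : ℕ → z) : Hp z ω n A :=
  RingQuot.mkAlgHom z (CRel z ω n A) (Rg z ω)
/-- the image of K in the cyclotomic Hecke algebra -/
def Kp (n : ℕ) (A : ℕ → z) : Hp z ω n A :=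
  RingQuot.mkAlgHom z (CRel z ω n A) (Kg z ω)
/-- Y = RKR in the cyclotomic Hecke algebra -/
def Yp (n : ℕ) (A : ℕ → z) : Hp z ω n A := Rp z ω n A * Kp z ω n A * Rp z ω n A

/-- the elements e_{i;j} = KⁱRKʲ - KʲRKⁱ of the cyclotomic Hecke algebra -/
def eHp (n : ℕ) (A : ℕ → z) (i j : ℕ) : Hp z ω n A :=
  Kp z ω n A ^ i * Rp z ω n A * Kp z ω n A ^ j -
    Kp z ω n A ^ j * Rp z ω n A * Kp z ω n A ^ i

/-- the element K̃ = Kⁿ - A₀K^(n-1) - ⋯ - A_(n-1) of the cyclotomic Hecke algebra -/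
def Ktil (n : ℕ) (A : ℕ → z) : Hp z ω n A :=
  Kp z ω n A ^ n - ∑ i ∈ Finset.range n, A i • Kp z ω n A ^ (n - 1 - i)

/-! ## Rational functions in one and two variables, and the spectral reflection equation -/

/-- polynomials in two variables x, y over the base field -/
abbrev P2 := MvPolynomial (Fin 2) k
/-- the field k(x,y) of rational functions in the two variables x, y -/
abbrev F2 := FractionRing (P2 k)

/-- auxiliary: the embedding k[X] → k(x,y), X ↦ i-th variable -/
def embP (i : Fin 2) : Polynomial k →ₐ[k] F2 k :=
  (IsScalarTower.toAlgHom k (P2 k) (F2 k)).comp (Polynomial.aeval (MvPolynomial.X i))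

lemma embP_injective (i : Fin 2) : Function.Injective (embP k i) := by
  have h : ((MvPolynomial.aeval (R := k) (fun j => if j = i then Polynomial.X else 0)).comp
      (Polynomial.aeval (R := k) (MvPolynomial.X i : P2 k))) = AlgHom.id k (Polynomial k) := by
    apply Polynomial.algHom_ext; simp
  have hinj : Function.Injective (Polynomial.aeval (R := k) (MvPolynomial.X i : P2 k)) := by
    intro a b hab
    have h2 := congrArg (MvPolynomial.aeval (R := k)
      (fun j : Fin 2 => if j = i then (Polynomial.X : Polynomial k) else 0)) hab
    have ha := congrFun (congrArg (fun (f : Polynomial k →ₐ[k] Polynomial k) =>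
      (f : Polynomial k → Polynomial k)) h) a
    have hb := congrFun (congrArg (fun (f : Polynomial k →ₐ[k] Polynomial k) =>
      (f : Polynomial k → Polynomial k)) h) b
    simp only [AlgHom.coe_comp, Function.comp_apply, AlgHom.coe_id, id_eq] at ha hb
    rw [← ha, ← hb]; exact h2
  exact (IsFractionRing.injective (P2 k) (F2 k)).comp hinj

/-- the embedding k(x) → k(x,y) sending the variable to the i-th of the two variables -/
def emb (i : Fin 2) : RatFunc k →ₐ[k] F2 k :=
  RatFunc.liftAlgHom (embP k i)
    (nonZeroDivisors_le_comap_nonZeroDivisors_of_injective _ (embP_injective k i))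

/-- the first spectral variable x, as an element of k(x,y) -/
def xvar : F2 k := algebraMap (P2 k) (F2 k) (MvPolynomial.X 0)
/-- the second spectral variable y, as an element of k(x,y) -/
def yvar : F2 k := algebraMap (P2 k) (F2 k) (MvPolynomial.X 1)

variable {B : Type} [Ring B] [Algebra k B]

/-- substitution of the spectral variable x by the i-th of the two variables x, y:
the map B(x) → B(x,y) induced by `emb i`. -/
def iota (i : Fin 2) : RatFunc k ⊗[k] B →ₐ[k] F2 k ⊗[k] B :=
  Algebra.TensorProduct.map (emb k i) (AlgHom.id k B)

/-- the baxterized R-matrix `R(t) = R - t⁻¹ R⁻¹` (note `R⁻¹ = R - ω` by the Hecke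
condition), as an element of B(x,y). -/
def RxElt (ωk : k) (Relt : B) (t : F2 k) : F2 k ⊗[k] B :=
  (1 : F2 k) ⊗ₜ[k] Relt - t⁻¹ • ((1 : F2 k) ⊗ₜ[k] (Relt - algebraMap k B ωk))

/-- `c`, viewed as an element `K(x)` of `B(x)`, satisfies the reflection equation with
spectral parameter:  `R(x/y) K(x) R(xy) K(y) = K(y) R(xy) K(x) R(x/y)` in B(x,y). -/
def IsSol (ωk : k) (Relt : B) (c : RatFunc k ⊗[k] B) : Prop :=
  RxElt k ωk Relt (xvar k / yvar k) * iota k 0 c * RxElt k ωk Relt (xvar k * yvar k) *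
      iota k 1 c =
    iota k 1 c * RxElt k ωk Relt (xvar k * yvar k) * iota k 0 c *
      RxElt k ωk Relt (xvar k / yvar k)

variable [Algebra z B]

/-- `c` lies in `𝔷(x)·1`, i.e. `c` is a scalar element of `B(x)`
(an element with trivial B-component). -/
def IsScalarElt (c : RatFunc k ⊗[k] B) : Prop :=
  c ∈ Submodule.span (RatFunc k)
    (Set.range fun a : z => (1 : RatFunc k) ⊗ₜ[k] (algebraMap z B a))

/-- the functions φ_i(ξ,x) (φ₀ = 1, φ_{i+1} = φ_i·ξx - A_i),
viewed as (central, scalar) elements of B(x). -/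
def phiT (ξ : z) (A : ℕ → z) : ℕ → RatFunc k ⊗[k] B
  | 0 => 1
  | (i + 1) => phiT ξ A i * ((RatFunc.X : RatFunc k) ⊗ₜ[k] algebraMap z B ξ)
      - (1 : RatFunc k) ⊗ₜ[k] (algebraMap z B (A i))

/-- the principal baxterized element
`K_p(ξ,ζ,x) = ∑_{i=0}^{n-1} φ_i(ξ,x) K^{n-i} + (ζ - x⁻¹ φ_n(ξ,x))/(x - x⁻¹)`,
as an element of 𝒦_p(x) ⊆ H_p(x). -/
def KxMain (n : ℕ) (A : ℕ → z) (ξ ζ : z) : RatFunc k ⊗[k] Hp z ω n A :=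
  (∑ i ∈ Finset.range n,
      phiT k z (B := Hp z ω n A) ξ A i * ((1 : RatFunc k) ⊗ₜ[k] (Kp z ω n A) ^ (n - i))) +
    ((RatFunc.X - RatFunc.X⁻¹)⁻¹ : RatFunc k) •
      ((1 : RatFunc k) ⊗ₜ[k] algebraMap z (Hp z ω n A) ζ -
        (RatFunc.X⁻¹ : RatFunc k) • phiT k z (B := Hp z ω n A) ξ A n)

/-- the scalar function ψ(ξ,ζ,x) = (-ξⁿx^{n+1} + ∑_{i=0}^{n-1} A_i ξ^{n-1-i} x^{n-i} + ζ)/(x-x⁻¹),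
viewed as a (scalar) element of H_p(x). -/
def psiT (n : ℕ) (A : ℕ → z) (ξ ζ : z) : RatFunc k ⊗[k] Hp z ω n A :=
  ((RatFunc.X - RatFunc.X⁻¹)⁻¹ : RatFunc k) •
    (((∑ i ∈ Finset.range n,
        (RatFunc.X ^ (n - i) : RatFunc k) ⊗ₜ[k]
          algebraMap z (Hp z ω n A) (A i * ξ ^ (n - 1 - i))) +
      (1 : RatFunc k) ⊗ₜ[k] algebraMap z (Hp z ω n A) ζ) -
      ((RatFunc.X ^ (n + 1) : RatFunc k) ⊗ₜ[k] algebraMap z (Hp z ω n A) (ξ ^ n)))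

/-- An element of 𝒦_p(x) is a *principal* solution if n = 1, or if n > 1 and the
coefficient of K^(n-1) in its expansion over the basis {1, K, …, K^(n-1), K̃} of 𝒦_p,
where K̃ = Kⁿ - A₀K^(n-1) - ⋯ - A_(n-1), is non-zero. -/
def IsPrincipal (n : ℕ) (A : ℕ → z) (c : RatFunc k ⊗[k] Hp z ω n A) : Prop :=
  n = 1 ∨ (1 < n ∧ ∃ f : ℕ → RatFunc k ⊗[k] Hp z ω n A,
    (∀ i, IsScalarElt k z (B := Hp z ω n A) (f i)) ∧
    c = (∑ i ∈ Finset.range n, f i * ((1 : RatFunc k) ⊗ₜ[k] (Kp z ω n A) ^ i)) +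
        f n * ((1 : RatFunc k) ⊗ₜ[k] Ktil z ω n A) ∧
    f (n - 1) ≠ 0)

/-! ## Commutative auxiliaries: the polynomial p, the functions φ and the coefficients A⁽ᵐ⁾ -/

/-- the polynomial p(u) = -u^(n+1) + A₀ uⁿ + ⋯ + Aₙ -/
def pPoly (n : ℕ) (A : ℕ → z) : Polynomial z :=
  - Polynomial.X ^ (n + 1) +
    ∑ i ∈ Finset.range (n + 1), Polynomial.C (A i) * Polynomial.X ^ (n - i)

/-- the polynomials φ_i(ξ,x) ∈ 𝔷[x]: φ₀ = 1, φ_{i+1} = φ_i·ξx - A_i -/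
def phiP (A : ℕ → z) (ξ : z) : ℕ → Polynomial z
  | 0 => 1
  | (i + 1) => phiP A ξ i * (Polynomial.C ξ * Polynomial.X) - Polynomial.C (A i)

/-- the monic polynomial u^(n+1) - A₀uⁿ - ⋯ - Aₙ (i.e. -p(u)) -/
def qPoly (n : ℕ) (A : ℕ → z) : Polynomial z :=
  Polynomial.X ^ (n + 1) -
    ∑ i ∈ Finset.range (n + 1), Polynomial.C (A i) * Polynomial.X ^ (n - i)

/-- the coefficients A⁽ᵐ⁾_i ∈ 𝔷 defined by uᵐ ≡ ∑_{i=0}^n A⁽ᵐ⁾_i u^{n-i}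
modulo the monic polynomial u^(n+1) - A₀uⁿ - ⋯ - Aₙ -/
def Am (n : ℕ) (A : ℕ → z) (m i : ℕ) : z :=
  ((Polynomial.X : Polynomial z) ^ m %ₘ qPoly z n A).coeff (n - i)

/-- polynomials in two variables over 𝔷 -/
abbrev ZP2 := MvPolynomial (Fin 2) z

/-- the embedding 𝔷[u] → 𝔷[x,y] sending u to the i-th variable -/
def evP (i : Fin 2) : Polynomial z →ₐ[z] ZP2 z := Polynomial.aeval (MvPolynomial.X i)

/-- The subalgebra 𝒦_p(x) of H_p(x): rational functions of x with values in the
subalgebra 𝒦_p ⊆ H_p generated by K (over 𝔷). -/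
def KpX (n : ℕ) (A : ℕ → z) : Subalgebra (RatFunc k) (RatFunc k ⊗[k] Hp z ω n A) :=
  Algebra.adjoin (RatFunc k)
    ({(1 : RatFunc k) ⊗ₜ[k] Kp z ω n A} ∪
      Set.range (fun a : z => (1 : RatFunc k) ⊗ₜ[k] algebraMap z (Hp z ω n A) a))

/-- Horner evaluation at `w` of the polynomial `a₀ wⁿ⁻¹ + a₁ wⁿ⁻² + ⋯ + aₙ₋₁`. -/
def horner {T : Type*} [CommRing T] (a : ℕ → T) (w : T) : ℕ → T
  | 0 => 0
  | n + 1 => w * horner a w n + a n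

/-- The divided difference `(horner a u n - horner a v n) / (u - v)`, computed recursively. -/
def hornerDiff {T : Type*} [CommRing T] (a : ℕ → T) (u v : T) : ℕ → T
  | 0 => 0
  | n + 1 => u * hornerDiff a u v n + horner a v n

/-- The coefficient sequence `1, -A₀, -A₁, …` of the polynomial `-p`. -/
def monicCoeff {T : Type*} [CommRing T] (A : ℕ → T) : ℕ → T
  | 0 => 1
  | i + 1 => -A i

section Commutative

variable {T : Type*} [CommRing T]

lemma horner_eq_sum (a : ℕ → T) (w : T) (n : ℕ) :
    horner a w n = ∑ i ∈ Finset.range n, a i * w ^ (n - 1 - i) := by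
  induction n with
  | zero => simp [horner]
  | succ n ih =>
    rw [Finset.sum_range_succ, horner, ih, Finset.mul_sum]
    congr 1
    · refine Finset.sum_congr rfl fun i hi => ?_
      have : n + 1 - 1 - i = (n - 1 - i) + 1 := by have := Finset.mem_range.mp hi; omega
      rw [this]; ring
    · simp

lemma mul_horner_eq_sum (a : ℕ → T) (w : T) (n : ℕ) :
    w * horner a w n = ∑ i ∈ Finset.range n, a i * w ^ (n - i) := by
  rw [horner_eq_sum, Finset.mul_sum]
  refine Finset.sum_congr rfl fun i hi => ?_
  have : n - i = (n - 1 - i) + 1 := by have := Finset.mem_range.mp hi; omega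
  rw [this]; ring

lemma horner_monicCoeff (A : ℕ → T) (w : T) (n : ℕ) :
    horner (monicCoeff A) w (n + 1) = w ^ n - horner A w n := by
  induction n with
  | zero => simp [horner, monicCoeff]
  | succ n ih => rw [horner, ih, horner, monicCoeff]; ring

lemma horner_sub (a : ℕ → T) (u v : T) (n : ℕ) :
    horner a u n - horner a v n = (u - v) * hornerDiff a u v n := by
  induction n with
  | zero => simp [horner, hornerDiff]
  | succ n ih => simp only [horner, hornerDiff]; linear_combination u * ih

variable {A φ : ℕ → T} {τ : T}

lemma sub_mul_horner (h0 : φ 0 = 1) (h : ∀ i, φ (i + 1) = φ i * τ - A i) (w : T) (n : ℕ) :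
    (w - τ) * horner φ w n = horner (monicCoeff A) w (n + 1) - φ n := by
  induction n with
  | zero => simp [horner, monicCoeff, h0]
  | succ n ih =>
    rw [horner, horner, h, monicCoeff]
    linear_combination w * ih

lemma sub_mul_hornerDiff (h0 : φ 0 = 1) (h : ∀ i, φ (i + 1) = φ i * τ - A i) (u v : T) (n : ℕ) :
    (u - τ) * hornerDiff φ u v n + horner φ v n = hornerDiff (monicCoeff A) u v (n + 1) := by
  induction n with
  | zero => simp [horner, hornerDiff]
  | succ n ih =>
    rw [hornerDiff, hornerDiff]
    rw [horner]
    linear_combination u * ih + sub_mul_horner h0 h v n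

/-- The scalar identity behind the reflection equation, divisible by the divided difference
`u * Q + πv` of the characteristic polynomial. -/
lemma reflection_scalar {u v ξ ζ x x' y y' : T} (hx : x * x' = 1) (hy : y * y' = 1)
    {φ ψ s r ℓu ℓv D mu mv E πu πv Q : T}
    (hs : (x - x') * s = ζ - x' * φ) (hr : (y - y') * r = ζ - y' * ψ)
    (hℓ : ℓu - ℓv = (u - v) * D) (hm : mu - mv = (u - v) * E) (hπ : πu - πv = (u - v) * Q)
    (hℓv : (v - ξ * x) * ℓv = πv - φ) (hmv : (v - ξ * y) * mv = πv - ψ)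
    (hD : (u - ξ * x) * D + ℓv = Q) (hE : (u - ξ * y) * E + mv = Q)
    (hp : u * πu = ξ * ζ) :
    (1 - y * x') * (1 - x' * y') * ((v * ℓv + s) - v * (u * D + ℓv)) * (u * E + mv)
      + (1 - y * x') * (x' * y') * ((u * D + ℓv) * (u * mu + r) + (v * ℓv + s) * (u * E + mv))
      + (1 - x' * y') * (y * x') * ((u * ℓu + s) * (u * E + mv) - (u * mu + r) * (u * D + ℓv))
    = x' * ((u * (y * E - x * D) - x' * (u * E + mv) + y' * (u * D + ℓv)) * (u * Q + πv)) := by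
  obtain rfl : ℓv = Q - (u - ξ * x) * D := by linear_combination hD
  obtain rfl : mv = Q - (u - ξ * y) * E := by linear_combination hE
  obtain rfl : φ = πv - (v - ξ * x) * (Q - (u - ξ * x) * D) := by linear_combination hℓv
  obtain rfl : ψ = πv - (v - ξ * y) * (Q - (u - ξ * y) * E) := by linear_combination hmv
  obtain rfl : ℓu = Q - (u - ξ * x) * D + (u - v) * D := by linear_combination hℓ
  obtain rfl : mu = Q - (u - ξ * y) * E + (u - v) * E := by linear_combination hm
  obtain rfl : πu = πv + (u - v) * Q := by linear_combination hπ
  have e₁ : 1 - y * x' * (x' * y') = x' * (x - x') := by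
    linear_combination -hx - x' * x' * hy
  have e₂ : x' * y' - y * x' = -(x' * (y - y')) := by ring
  have e₃ : 1 - y * x' = x' * (x - y) := by linear_combination -hx
  have e₄ : x * (1 - y * x' * (x' * y')) + y * (x' * y' - y * x') = x' * ((x - y) * (x + y)) := by
    rw [e₁]; linear_combination -x' * hx + x' * hy
  generalize hC : s - (πv - (v - ξ * x) * (Q - (u - ξ * x) * D)) + (u * Q + πv) = C
  generalize hC' : r - (πv - (v - ξ * y) * (Q - (u - ξ * y) * E)) + (u * Q + πv) = C'
  have core : (x - x') * (C * (ξ * y * E + Q)) - (y - y') * (C' * (ξ * x * D + Q))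
        - (x - y) * ((ξ * x * D + Q) * (ξ * y * E + Q) * (u + v - ξ * (x + y)))
      = (u * (y * E - x * D) - x' * (ξ * y * E + Q) + y' * (ξ * x * D + Q)) * (u * Q + πv) := by
    rw [← hC, ← hC']
    linear_combination (ξ * y * E + Q) * hs - (ξ * x * D + Q) * hr - (y * E - x * D) * hp
  calc
    _ = (1 - y * x' * (x' * y')) * (C * (ξ * y * E + Q))
        + (x' * y' - y * x') * (C' * (ξ * x * D + Q))
        - (1 - y * x') * ((ξ * x * D + Q) * (ξ * y * E + Q) * (u + v))
        + (x * (1 - y * x' * (x' * y')) + y * (x' * y' - y * x'))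
          * (ξ * ((ξ * x * D + Q) * (ξ * y * E + Q))) := by rw [← hC, ← hC']; ring
    _ = x' * ((x - x') * (C * (ξ * y * E + Q)) - (y - y') * (C' * (ξ * x * D + Q))
        - (x - y) * ((ξ * x * D + Q) * (ξ * y * E + Q) * (u + v - ξ * (x + y)))) := by
      rw [e₄, e₁, e₂, e₃]; ring
    _ = _ := by rw [core]; ring

end Commutative

section Intertwiner

variable {S T C : Type*} [CommRing S] [CommRing T] [Algebra S T] [Ring C] [Algebra S C]

/-- The image of `f` moves past `R`, turning into `f'` with correction term given by the divided
difference `D`: the Bernstein relation in `C`. -/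
def Crosses (j : T →ₐ[S] C) (R : C) (v : T) (w : S) (f f' D : T) : Prop :=
  R * j f = j f' * R - j (algebraMap S T w * v * D)

namespace Crosses

variable {j : T →ₐ[S] C} {R : C} {u v : T} {w : S} {f f' D g g' E : T}

lemma const (s : S) : Crosses j R v w (algebraMap S T s) (algebraMap S T s) 0 := by
  simp [Crosses, Algebra.commutes]

lemma add (hf : Crosses j R v w f f' D) (hg : Crosses j R v w g g' E) :
    Crosses j R v w (f + g) (f' + g') (D + E) := by
  unfold Crosses at *
  simp only [map_add, mul_add, add_mul, hf, hg]
  abel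

lemma mul (hf : Crosses j R v w f f' D) (hg : Crosses j R v w g g' E) :
    Crosses j R v w (f * g) (f' * g') (D * g + f' * E) := by
  unfold Crosses at *
  have : algebraMap S T w * v * (D * g + f' * E)
      = f' * (algebraMap S T w * v * E) + algebraMap S T w * v * D * g := by ring
  rw [this, map_mul, ← mul_assoc, hf, sub_mul, mul_assoc, hg, mul_sub, map_add, map_mul j f' g',
    map_mul j f', map_mul j _ g, ← mul_assoc, sub_sub]

lemma horner (hu : Crosses j R v w u v 1) (a : ℕ → S) (n : ℕ) :
    Crosses j R v w (horner (fun i => algebraMap S T (a i)) u n)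
      (Baxterization.horner (fun i => algebraMap S T (a i)) v n)
      (hornerDiff (fun i => algebraMap S T (a i)) u v n) := by
  induction n with
  | zero => simp [Crosses, Baxterization.horner, hornerDiff]
  | succ n ih =>
    convert (hu.mul ih).add (const (a n)) using 1
    · rfl
    · rfl
    rw [hornerDiff]
    linear_combination -horner_sub (fun i => algebraMap S T (a i)) u v n

lemma normal_mul {α β : T} (hf : Crosses j R v w f f' D) :
    (j α + j β * R) * j f = j (α * f - β * (algebraMap S T w * v * D)) + j (β * f') * R := by
  rw [add_mul, mul_assoc, hf]
  simp only [map_sub, map_mul]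
  noncomm_ring

end Crosses

variable {j : T →ₐ[S] C} {R : C} {u v : T} {w : S}

lemma normal_mul_const (hR : R * R = w • R + 1) (α β : T) (b a : S) :
    (j α + j β * R) * (j (algebraMap S T b) + j (algebraMap S T a) * R)
      = j (α * algebraMap S T b + β * algebraMap S T a)
        + j (α * algebraMap S T a + β * algebraMap S T b
          + β * algebraMap S T a * algebraMap S T w) * R := by
  have hc (s : S) : R * j (algebraMap S T s) = j (algebraMap S T s) * R := by
    rw [AlgHom.commutes]; exact (Algebra.commutes _ _).symm
  have h₁ : j β * R * j (algebraMap S T b) = j β * j (algebraMap S T b) * R := by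
    rw [mul_assoc, hc, mul_assoc]
  have h₂ : j β * R * (j (algebraMap S T a) * R)
      = j β * j (algebraMap S T a) * (j (algebraMap S T w) * R + 1) := by
    rw [← mul_assoc, mul_assoc (j β), hc, ← mul_assoc, mul_assoc, hR, AlgHom.commutes j w,
      ← Algebra.smul_def]
  rw [add_mul, mul_add, mul_add, h₁, h₂]
  simp only [map_add, map_mul]
  noncomm_ring

lemma reflection_of_scalar (hR : R * R = w • R + 1) {f f' D g g' E Δ Γ : T} (t t' : S)
    (hf : Crosses j R v w f f' D) (hg : Crosses j R v w g g' E)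
    (hfd : f - f' = (u - v) * D) (hgd : g - g' = (u - v) * E)
    (hΔ : j Δ * (j (u - v) * R + j (algebraMap S T w * v)) = 0)
    (hZ : (1 - algebraMap S T t) * (1 - algebraMap S T t') * (f' - v * D) * E
      + (1 - algebraMap S T t) * algebraMap S T t' * (D * g + f' * E)
      + (1 - algebraMap S T t') * algebraMap S T t * (f * E - g * D) = Γ * Δ) :
    (R - t • (R - w • 1)) * j f * (R - t' • (R - w • 1)) * j g
      = j g * (R - t' • (R - w • 1)) * j f * (R - t • (R - w • 1)) := by
  have hbax (s : S) : R - s • (R - w • 1)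
      = j (algebraMap S T (s * w)) + j (algebraMap S T (1 - s)) * R := by
    rw [AlgHom.commutes, AlgHom.commutes, ← Algebra.smul_def, Algebra.algebraMap_eq_smul_one,
      smul_sub, sub_smul, smul_smul, one_smul]
    abel
  have hleft (γ α β : T) : j γ * (j α + j β * R) = j (γ * α) + j (γ * β) * R := by
    simp only [map_mul]; noncomm_ring
  rw [hbax, hbax, hf.normal_mul, normal_mul_const hR, hg.normal_mul, hleft, hf.normal_mul,
    normal_mul_const hR, ← sub_eq_zero, add_sub_add_comm, ← sub_mul, ← map_sub, ← map_sub]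
  obtain rfl : f = f' + (u - v) * D := by linear_combination hfd
  obtain rfl : g = g' + (u - v) * E := by linear_combination hgd
  have hz : j (-algebraMap S T w * Γ * Δ * (algebraMap S T w * v))
      + j (-algebraMap S T w * Γ * Δ * (u - v)) * R = 0 := by
    rw [map_mul j _ (u - v), map_mul j _ (_ * v), mul_assoc (j _), ← mul_add, map_mul j _ Δ,
      mul_assoc, add_comm, hΔ, mul_zero]
  convert hz using 4
  · simp only [map_sub, map_one, map_mul]
    linear_combination -(algebraMap S T w * (algebraMap S T w * v)) * hZ
  · simp only [map_sub, map_one, map_mul]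
    linear_combination -(algebraMap S T w * (u - v)) * hZ

/-- The baxterized element solves the reflection equation as soon as `u` moves past `R` by the
Bernstein relation and is a root of the characteristic polynomial. -/
theorem reflection_of_crosses (hR : R * R = w • R + 1) (hu : Crosses j R v w u v 1)
    {A φ ψ : ℕ → S} {ξ ζ x x' y y' s r : S} (n : ℕ) (hx : x * x' = 1) (hy : y * y' = 1)
    (hφ0 : φ 0 = 1) (hφ : ∀ i, φ (i + 1) = φ i * (ξ * x) - A i)
    (hψ0 : ψ 0 = 1) (hψ : ∀ i, ψ (i + 1) = ψ i * (ξ * y) - A i)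
    (hs : (x - x') * s = ζ - x' * φ n) (hr : (y - y') * r = ζ - y' * ψ n)
    (hp : u * horner (fun i => algebraMap S T (monicCoeff A i)) u (n + 1)
      = algebraMap S T (ξ * ζ)) :
    (R - (y * x') • (R - w • 1))
        * j (u * horner (fun i => algebraMap S T (φ i)) u n + algebraMap S T s)
        * (R - (x' * y') • (R - w • 1))
        * j (u * horner (fun i => algebraMap S T (ψ i)) u n + algebraMap S T r)
      = j (u * horner (fun i => algebraMap S T (ψ i)) u n + algebraMap S T r)
        * (R - (x' * y') • (R - w • 1))
        * j (u * horner (fun i => algebraMap S T (φ i)) u n + algebraMap S T s)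
        * (R - (y * x') • (R - w • 1)) := by
  have hmc : (fun i => algebraMap S T (monicCoeff A i))
      = monicCoeff fun i => algebraMap S T (A i) := by
    funext i; cases i <;> simp [monicCoeff]
  have hℓ := horner_sub (fun i => algebraMap S T (φ i)) u v n
  have hm := horner_sub (fun i => algebraMap S T (ψ i)) u v n
  have hπ := horner_sub (fun i => algebraMap S T (monicCoeff A i)) u v (n + 1)
  have hφ0' : (fun i => algebraMap S T (φ i)) 0 = 1 := by simp [hφ0]
  have hψ0' : (fun i => algebraMap S T (ψ i)) 0 = 1 := by simp [hψ0]
  have hφ' (i : ℕ) : (fun i => algebraMap S T (φ i)) (i + 1) = (fun i => algebraMap S T (φ i)) i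
      * (algebraMap S T ξ * algebraMap S T x) - (fun i => algebraMap S T (A i)) i := by simp [hφ]
  have hψ' (i : ℕ) : (fun i => algebraMap S T (ψ i)) (i + 1) = (fun i => algebraMap S T (ψ i)) i
      * (algebraMap S T ξ * algebraMap S T y) - (fun i => algebraMap S T (A i)) i := by simp [hψ]
  have hcross (a : ℕ → S) (m : ℕ) (c : S) := (hu.mul (hu.horner a m)).add (.const c)
  refine reflection_of_scalar hR _ _ (hcross φ n s) (hcross ψ n r) (u := u)
    (Δ := u * hornerDiff (fun i => algebraMap S T (monicCoeff A i)) u v (n + 1)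
      + horner (fun i => algebraMap S T (monicCoeff A i)) v (n + 1))
    (by linear_combination v * hℓ) (by linear_combination v * hm) ?_ ?_ (Γ := ?_)
  · exact algebraMap S T x' * (u *
        (algebraMap S T y * hornerDiff (fun i => algebraMap S T (ψ i)) u v n
        - algebraMap S T x * hornerDiff (fun i => algebraMap S T (φ i)) u v n)
      - algebraMap S T x' * (u * hornerDiff (fun i => algebraMap S T (ψ i)) u v n
        + horner (fun i => algebraMap S T (ψ i)) v n)
      + algebraMap S T y' * (u * hornerDiff (fun i => algebraMap S T (φ i)) u v n
        + horner (fun i => algebraMap S T (φ i)) v n))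
  · have h := hcross (monicCoeff A) (n + 1) (-(ξ * ζ))
    rw [Crosses, hp, map_neg, add_neg_cancel, map_zero, mul_zero, eq_comm, ← neg_eq_zero,
      neg_sub', sub_neg_eq_add, ← neg_mul, ← map_neg] at h
    rw [mul_add, ← mul_assoc, ← map_mul, ← map_mul]
    refine Eq.trans (congrArg₂ _ (congrArg (fun t => j t * R) ?_) (congrArg j ?_)) h
    · linear_combination hp - u * hπ
    · linear_combination -(algebraMap S T w * v) * hπ
  · have key := reflection_scalar (T := T) (x := algebraMap S T x) (x' := algebraMap S T x')
      (y := algebraMap S T y) (y' := algebraMap S T y') (ξ := algebraMap S T ξ)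
      (ζ := algebraMap S T ζ) (s := algebraMap S T s) (r := algebraMap S T r)
      (by rw [← map_mul, hx, map_one]) (by rw [← map_mul, hy, map_one])
      (by simpa using congrArg (algebraMap S T) hs) (by simpa using congrArg (algebraMap S T) hr)
      hℓ hm hπ (hmc ▸ sub_mul_horner hφ0' hφ' v n) (hmc ▸ sub_mul_horner hψ0' hψ' v n)
      (hmc ▸ sub_mul_hornerDiff hφ0' hφ' u v n) (hmc ▸ sub_mul_hornerDiff hψ0' hψ' u v n)
      (by rw [hp, map_mul])
    have hD : u * hornerDiff (fun i => algebraMap S T (φ i)) u v n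
          + horner (fun i => algebraMap S T (φ i)) v n
        = 1 * horner (fun i => algebraMap S T (φ i)) u n
          + v * hornerDiff (fun i => algebraMap S T (φ i)) u v n + 0 := by linear_combination -hℓ
    have hE : u * hornerDiff (fun i => algebraMap S T (ψ i)) u v n
          + horner (fun i => algebraMap S T (ψ i)) v n
        = 1 * horner (fun i => algebraMap S T (ψ i)) u n
          + v * hornerDiff (fun i => algebraMap S T (ψ i)) u v n + 0 := by linear_combination -hm
    rw [hD, hE] at key
    rw [map_mul, map_mul, hD, hE]
    linear_combination key

open scoped IsMulCommutative in
/-- The baxterized element solves the reflection equation in any quotient of the affine Hecke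
algebra in which `K` satisfies the characteristic equation. -/
theorem reflection_of_hecke {K : C} (hR : R * R = w • R + 1) (hK : R * K * R * K = K * R * K * R)
    {A φ ψ : ℕ → S} {ξ ζ x x' y y' s r : S} (n : ℕ) (hx : x * x' = 1) (hy : y * y' = 1)
    (hφ0 : φ 0 = 1) (hφ : ∀ i, φ (i + 1) = φ i * (ξ * x) - A i)
    (hψ0 : ψ 0 = 1) (hψ : ∀ i, ψ (i + 1) = ψ i * (ξ * y) - A i)
    (hs : (x - x') * s = ζ - x' * φ n) (hr : (y - y') * r = ζ - y' * ψ n)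
    (hp : K ^ (n + 1) = ∑ i ∈ Finset.range n, A i • K ^ (n - i) + algebraMap S C (ξ * ζ))
    {f g : C} (hf : f = ∑ i ∈ Finset.range n, φ i • K ^ (n - i) + algebraMap S C s)
    (hg : g = ∑ i ∈ Finset.range n, ψ i • K ^ (n - i) + algebraMap S C r) :
    (R - (y * x') • (R - w • 1)) * f * (R - (x' * y') • (R - w • 1)) * g
      = g * (R - (x' * y') • (R - w • 1)) * f * (R - (y * x') • (R - w • 1)) := by
  have hcomm : ∀ a ∈ ({K, R * K * R} : Set C), ∀ b ∈ ({K, R * K * R} : Set C), a * b = b * a := by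
    have h : K * (R * K * R) = R * K * R * K := by
      simpa only [mul_assoc] using hK.symm
    simp [h]
  have := Algebra.isMulCommutative_adjoin S hcomm
  let j : Algebra.adjoin S ({K, R * K * R} : Set C) →ₐ[S] C := Subalgebra.val _
  let u : Algebra.adjoin S ({K, R * K * R} : Set C) := ⟨K, Algebra.subset_adjoin (by simp)⟩
  let v : Algebra.adjoin S ({K, R * K * R} : Set C) := ⟨R * K * R, Algebra.subset_adjoin (by simp)⟩
  have hju : j u = K := rfl
  have hjv : j v = R * K * R := rfl
  have hu : Crosses j R v w u v 1 := by
    rw [Crosses, mul_one, map_mul, AlgHom.commutes, hju, hjv, mul_assoc _ R R, hR,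
      ← Algebra.smul_def]
    simp [mul_add, mul_assoc]
  have hval (a : ℕ → S) : j (u * horner (fun i => algebraMap S _ (a i)) u n)
      = ∑ i ∈ Finset.range n, a i • K ^ (n - i) := by
    rw [mul_horner_eq_sum, map_sum]
    simp only [map_mul, map_pow, AlgHom.commutes, hju, Algebra.smul_def]
  have hp' : u * horner (fun i => algebraMap S _ (monicCoeff A i)) u (n + 1)
      = algebraMap S _ (ξ * ζ) := by
    have hmc : (fun i => algebraMap S (Algebra.adjoin S ({K, R * K * R} : Set C)) (monicCoeff A i))
        = monicCoeff fun i => algebraMap S _ (A i) := by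
      funext i; cases i <;> simp [monicCoeff]
    have hj : Function.Injective j := Subtype.val_injective
    apply hj
    rw [hmc, horner_monicCoeff, mul_sub, map_sub, hval, ← pow_succ', map_pow, hju, hp,
      AlgHom.commutes, add_sub_cancel_left]
  have := reflection_of_crosses hR hu n hx hy hφ0 hφ hψ0 hψ hs hr hp'
  simpa only [map_add, hval, AlgHom.commutes, ← hf, ← hg] using this

end Intertwiner

/-- `reflection_of_hecke` for scalars acting through a central ring homomorphism. -/
theorem reflection_of_central {S C : Type*} [CommRing S] [Ring C] (σ : S →+* C)
    (hσ : ∀ a b, σ a * b = b * σ a) {R K : C} {w : S} (hR : R * R = σ w * R + 1)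
    (hK : R * K * R * K = K * R * K * R)
    {A φ ψ : ℕ → S} {ξ ζ x x' y y' s r : S} (n : ℕ) (hx : x * x' = 1) (hy : y * y' = 1)
    (hφ0 : φ 0 = 1) (hφ : ∀ i, φ (i + 1) = φ i * (ξ * x) - A i)
    (hψ0 : ψ 0 = 1) (hψ : ∀ i, ψ (i + 1) = ψ i * (ξ * y) - A i)
    (hs : (x - x') * s = ζ - x' * φ n) (hr : (y - y') * r = ζ - y' * ψ n)
    (hp : K ^ (n + 1) = ∑ i ∈ Finset.range n, σ (A i) * K ^ (n - i) + σ (ξ * ζ))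
    {f g : C} (hf : f = ∑ i ∈ Finset.range n, σ (φ i) * K ^ (n - i) + σ s)
    (hg : g = ∑ i ∈ Finset.range n, σ (ψ i) * K ^ (n - i) + σ r) :
    (R - σ (y * x') * (R - σ w)) * f * (R - σ (x' * y') * (R - σ w)) * g
      = g * (R - σ (x' * y') * (R - σ w)) * f * (R - σ (y * x') * (R - σ w)) := by
  let := σ.toAlgebra' hσ
  have hsmul (a : S) (b : C) : a • b = σ a * b := rfl
  have := reflection_of_hecke (w := w) hR hK n hx hy hφ0 hφ hψ0 hψ hs hr hp hf hg
  simpa only [hsmul, mul_one] using this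

/-! ## The scalars `F ⊗ 𝔷` and evaluation of the baxterized element -/

section Scalars

variable {z} (F : Type) [Field F] [Algebra k F] [IsScalarTower k z B]

/-- The map `F ⊗ 𝔷 → F ⊗ B` induced by the structure map of the `𝔷`-algebra `B`. -/
def scalarMap : F ⊗[k] z →ₐ[F] F ⊗[k] B :=
  Algebra.TensorProduct.map (AlgHom.id F F) (IsScalarTower.toAlgHom k z B)

variable {F}

@[simp]
lemma scalarMap_tmul (f : F) (a : z) :
    scalarMap k (B := B) F (f ⊗ₜ a) = f ⊗ₜ algebraMap z B a := rfl

lemma scalarMap_commute (c : F ⊗[k] z) (b : F ⊗[k] B) :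
    scalarMap k F c * b = b * scalarMap k F c := by
  induction c using TensorProduct.induction_on with
  | zero => simp
  | add c d hc hd => rw [map_add, add_mul, mul_add, hc, hd]
  | tmul f a =>
    induction b using TensorProduct.induction_on with
    | zero => simp
    | add c d hc hd => rw [add_mul, mul_add, hc, hd]
    | tmul g b => simp [mul_comm f g, Algebra.commutes a b]

lemma iota_scalarMap (i : Fin 2) (c : RatFunc k ⊗[k] z) :
    iota k i (scalarMap k (B := B) (RatFunc k) c) = scalarMap k (F2 k) (iota k i c) := by
  induction c using TensorProduct.induction_on with
  | zero => simp
  | add c d hc hd => simp only [map_add, hc, hd]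
  | tmul f a => simp [iota]

lemma scalarMap_phiT (ξ : z) (A : ℕ → z) (i : ℕ) :
    scalarMap k (B := B) (RatFunc k) (phiT k z (B := z) ξ A i) = phiT k z ξ A i := by
  induction i with
  | zero => simp [phiT]
  | succ i ih => simp [phiT, ih]

lemma isScalarElt_scalarMap (c : RatFunc k ⊗[k] z) :
    IsScalarElt k z (B := B) (scalarMap k (RatFunc k) c) := by
  induction c using TensorProduct.induction_on with
  | zero => rw [map_zero]; exact Submodule.zero_mem _
  | add c d hc hd => rw [map_add]; exact Submodule.add_mem _ hc hd
  | tmul f a =>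
    have : scalarMap k (B := B) (RatFunc k) (f ⊗ₜ a) =
        f • ((1 : RatFunc k) ⊗ₜ algebraMap z B a) := by
      simp [TensorProduct.smul_tmul']
    rw [this]
    exact Submodule.smul_mem _ _ (Submodule.subset_span ⟨a, rfl⟩)

end Scalars

lemma emb_X (i : Fin 2) :
    emb k i RatFunc.X = algebraMap (P2 k) (F2 k) (MvPolynomial.X i) := by
  rw [emb, ← RatFunc.algebraMap_X, RatFunc.liftAlgHom_apply]
  simp [embP]

lemma ratFunc_X_sub_inv_ne_zero : (RatFunc.X - RatFunc.X⁻¹ : RatFunc k) ≠ 0 := by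
  intro h
  have hX : (RatFunc.X : RatFunc k) ≠ 0 := RatFunc.X_ne_zero
  have h2 : (RatFunc.X : RatFunc k) ^ 2 = 1 := by
    field_simp at h
    linear_combination h
  have h3 : (Polynomial.X : Polynomial k) ^ 2 = 1 := by
    apply RatFunc.algebraMap_injective k
    simpa using h2
  have := congrArg Polynomial.natDegree h3
  simp at this

variable {z} in
/-- The constant term of the baxterized element, as an element of `k(x) ⊗ 𝔷`. -/
def constTerm (n : ℕ) (A : ℕ → z) (ξ ζ : z) : RatFunc k ⊗[k] z :=
  ((RatFunc.X - RatFunc.X⁻¹)⁻¹ : RatFunc k) •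
    ((1 : RatFunc k) ⊗ₜ ζ - (RatFunc.X⁻¹ : RatFunc k) • phiT k z (B := z) ξ A n)

variable {z} in
lemma KxMain_eq (n : ℕ) (A : ℕ → z) (ξ ζ : z) :
    KxMain k z ω n A ξ ζ = (∑ i ∈ Finset.range n,
      scalarMap k (RatFunc k) (phiT k z (B := z) ξ A i) *
        ((1 : RatFunc k) ⊗ₜ[k] (Kp z ω n A) ^ (n - i))) +
      scalarMap k (RatFunc k) (constTerm k n A ξ ζ) := by
  simp [KxMain, constTerm, scalarMap_phiT]

variable {z} in
lemma iota_constTerm (i : Fin 2) (n : ℕ) (A : ℕ → z) (ξ ζ : z) :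
    ((emb k i RatFunc.X) ⊗ₜ 1 - (emb k i RatFunc.X)⁻¹ ⊗ₜ 1) * iota k i (constTerm k n A ξ ζ) =
      1 ⊗ₜ ζ - ((emb k i RatFunc.X)⁻¹ ⊗ₜ 1) * iota k i (phiT k z (B := z) ξ A n) := by
  have h : ((RatFunc.X : RatFunc k) ⊗ₜ[k] (1 : z) - (RatFunc.X : RatFunc k)⁻¹ ⊗ₜ 1) *
      constTerm k n A ξ ζ =
      1 ⊗ₜ ζ - ((RatFunc.X : RatFunc k)⁻¹ ⊗ₜ 1) * phiT k z (B := z) ξ A n := by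
    have hs (f : RatFunc k) (c : RatFunc k ⊗[k] z) : f ⊗ₜ 1 * c = f • c := by
      rw [Algebra.smul_def]; rfl
    rw [← TensorProduct.sub_tmul, hs, hs, constTerm, smul_inv_smul₀ (ratFunc_X_sub_inv_ne_zero k)]
  have := congrArg (iota k i) h
  simpa [iota] using this

section Presentation

variable {z} {ω}

/-- The quotient map onto the affine Hecke algebra. -/
def mkH : FreeAlgebra z G →ₐ[z] H z ω := RingQuot.mkAlgHom z (HRel z ω)

lemma Rg_mul_self : Rg z ω * Rg z ω = ω • Rg z ω + 1 := by
  have h : mkH (z := z) (ω := ω) _ = mkH _ := RingQuot.mkAlgHom_rel z HRel.hecke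
  rwa [map_mul, map_add, map_smul, map_one] at h

lemma Rg_mul_Kg : Rg z ω * Kg z ω * Rg z ω * Kg z ω = Kg z ω * Rg z ω * Kg z ω * Rg z ω := by
  have h : mkH (z := z) (ω := ω) _ = mkH _ := RingQuot.mkAlgHom_rel z HRel.re
  rwa [map_mul, map_mul, map_mul, map_mul, map_mul, map_mul] at h

variable (n : ℕ) (A : ℕ → z)

/-- The quotient map onto the cyclotomic Hecke algebra. -/
def mkHp : H z ω →ₐ[z] Hp z ω n A := RingQuot.mkAlgHom z (CRel z ω n A)

lemma mkHp_Rg : mkHp n A (Rg z ω) = Rp z ω n A := rfl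

lemma mkHp_Kg : mkHp n A (Kg z ω) = Kp z ω n A := rfl

lemma Rp_mul_self : Rp z ω n A * Rp z ω n A = ω • Rp z ω n A + 1 := by
  have h := congrArg (mkHp n A) (Rg_mul_self (ω := ω))
  rwa [map_mul, map_add, map_smul, map_one, mkHp_Rg] at h

lemma Rp_mul_Kp : Rp z ω n A * Kp z ω n A * Rp z ω n A * Kp z ω n A =
    Kp z ω n A * Rp z ω n A * Kp z ω n A * Rp z ω n A := by
  have h := congrArg (mkHp n A) (Rg_mul_Kg (ω := ω))
  simpa only [map_mul, mkHp_Rg, mkHp_Kg] using h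

lemma Kp_pow_succ : Kp z ω n A ^ (n + 1) =
    ∑ i ∈ Finset.range n, A i • Kp z ω n A ^ (n - i) + algebraMap z _ (A n) := by
  have h : mkHp n A (pKelt z ω n A) = mkHp n A 0 := RingQuot.mkAlgHom_rel z CRel.mk
  simp only [pKelt, map_add, map_neg, map_pow, map_sum, map_smul, map_zero, mkHp_Kg] at h
  rw [Finset.sum_range_succ, Nat.sub_self, pow_zero, ← Algebra.algebraMap_eq_smul_one] at h
  exact neg_add_eq_zero.mp h

end Presentation

variable {z} {ω} in
lemma isSol_KxMain (c : k) (hω : ω = algebraMap k z c) (n : ℕ) (A : ℕ → z) (ξ ζ : z)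
    (h : ζ * ξ = A n) : IsSol k c (Rp z ω n A) (KxMain k z ω n A ξ ζ) := by
  have hvar (i : Fin 2) : emb k i RatFunc.X ≠ 0 := by
    rw [map_ne_zero]; exact RatFunc.X_ne_zero
  have h0 : emb k 0 RatFunc.X = xvar k := emb_X k 0
  have h1 : emb k 1 RatFunc.X = yvar k := emb_X k 1
  have hinv (i : Fin 2) : (emb k i RatFunc.X ⊗ₜ[k] (1 : z)) * ((emb k i RatFunc.X)⁻¹ ⊗ₜ 1) = 1 := by
    rw [Algebra.TensorProduct.tmul_mul_tmul, mul_inv_cancel₀ (hvar i), one_mul]; rfl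
  have hφ (i : Fin 2) (m : ℕ) : iota k i (phiT k z (B := z) ξ A (m + 1)) =
      iota k i (phiT k z (B := z) ξ A m) * (1 ⊗ₜ ξ * (emb k i RatFunc.X ⊗ₜ 1)) - 1 ⊗ₜ A m := by
    simp [phiT, iota]
  have hK (i : Fin 2) : iota k i (KxMain k z ω n A ξ ζ) =
      ∑ m ∈ Finset.range n, scalarMap k (F2 k) (iota k i (phiT k z (B := z) ξ A m)) *
        ((1 : F2 k) ⊗ₜ[k] Kp z ω n A) ^ (n - m) +
      scalarMap k (F2 k) (iota k i (constTerm k n A ξ ζ)) := by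
    rw [KxMain_eq, map_add, map_sum, iota_scalarMap]
    congr 1
    refine Finset.sum_congr rfl fun m _ => ?_
    rw [map_mul, iota_scalarMap]
    simp [iota]
  have hRx (a b t : F2 k) (ht : t⁻¹ = a * b) : RxElt k c (Rp z ω n A) t =
      1 ⊗ₜ Rp z ω n A - scalarMap k (F2 k) (a ⊗ₜ[k] (1 : z) * b ⊗ₜ 1) *
        ((1 : F2 k) ⊗ₜ[k] Rp z ω n A - scalarMap k (F2 k) ((1 : F2 k) ⊗ₜ[k] ω)) := by
    rw [RxElt, ht, Algebra.TensorProduct.tmul_mul_tmul, hω, mul_one,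
      scalarMap_tmul, scalarMap_tmul, map_one, ← IsScalarTower.algebraMap_apply,
      ← TensorProduct.tmul_sub, TensorProduct.smul_tmul', Algebra.TensorProduct.tmul_mul_tmul,
      smul_eq_mul, mul_one, one_mul]
  rw [IsSol, hRx (emb k 1 RatFunc.X) (emb k 0 RatFunc.X)⁻¹ (xvar k / yvar k)
    (by rw [h0, h1, inv_div, div_eq_mul_inv]), hRx (emb k 0 RatFunc.X)⁻¹ (emb k 1 RatFunc.X)⁻¹
    (xvar k * yvar k) (by rw [h0, h1, mul_inv])]
  refine reflection_of_central (scalarMap k (F2 k)).toRingHom (scalarMap_commute k)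
    (A := fun i => 1 ⊗ₜ A i) (ξ := 1 ⊗ₜ ξ) (ζ := 1 ⊗ₜ ζ)
    (K := 1 ⊗ₜ Kp z ω n A) ?_ ?_ n (hinv 0) (hinv 1) ?_ (hφ 0) ?_ (hφ 1)
    (iota_constTerm k 0 n A ξ ζ) (iota_constTerm k 1 n A ξ ζ) ?_ (hK 0) (hK 1)
  · change _ = scalarMap k (F2 k) _ * _ + _
    rw [scalarMap_tmul, Algebra.TensorProduct.tmul_mul_tmul, Rp_mul_self,
      TensorProduct.tmul_add, Algebra.TensorProduct.tmul_mul_tmul, Algebra.smul_def,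
      mul_one (1 : F2 k)]
    rfl
  · simp only [Algebra.TensorProduct.tmul_mul_tmul, Rp_mul_Kp]
  · exact map_one _
  · exact map_one _
  · change _ = ∑ i ∈ Finset.range n, scalarMap k (F2 k) _ * _ + scalarMap k (F2 k) _
    simp only [Algebra.TensorProduct.tmul_pow, Algebra.TensorProduct.tmul_mul_tmul,
      scalarMap_tmul, one_pow, one_mul, ← TensorProduct.tmul_sum, ← TensorProduct.tmul_add,
      Kp_pow_succ, Algebra.smul_def, ← h, mul_comm ξ ζ]

section Principal

variable {z} {ω}

/-- The character of the affine Hecke algebra with values in a commutative algebra which sends `R`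
to a root `r` of the Hecke relation and `K` to `u`. -/
def affineChar {D : Type} [CommRing D] [Algebra z D] {r : z} (hr : r * r = ω * r + 1) (u : D) :
    H z ω →ₐ[z] D :=
  RingQuot.liftAlgHom z ⟨FreeAlgebra.lift z fun
    | G.R => algebraMap z D r
    | G.K => u, by
      rintro _ _ (_ | _)
      · simp only [map_mul, map_add, map_smul, map_one, FreeAlgebra.lift_ι_apply]
        rw [← map_mul, hr, Algebra.smul_def, map_add, map_mul, map_one]
      · simp only [map_mul, FreeAlgebra.lift_ι_apply]
        ring⟩

lemma affineChar_Kg {D : Type} [CommRing D] [Algebra z D] {r : z} (hr : r * r = ω * r + 1) (u : D) :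
    affineChar hr u (Kg z ω) = u := by
  refine (RingQuot.liftAlgHom_mkAlgHom_apply ..).trans ?_
  rw [FreeAlgebra.lift_ι_apply]

lemma affineChar_pKelt {D : Type} [CommRing D] [Algebra z D] {r : z} (hr : r * r = ω * r + 1)
    (u : D) (n : ℕ) (A : ℕ → z) :
    affineChar hr u (pKelt z ω n A) = -Polynomial.aeval u (qPoly z n A) := by
  simp only [pKelt, qPoly, map_add, map_neg, map_sub, map_pow, map_sum, map_mul, map_smul,
    affineChar_Kg, Polynomial.aeval_X, Polynomial.aeval_C, ← Algebra.smul_def]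
  abel

/-- The character of the cyclotomic Hecke algebra with values in `𝔷[u]/(p)` which sends `R` to a
root `r` of the Hecke relation and `K` to the class of `u`. -/
def cyclotomicChar {r : z} (hr : r * r = ω * r + 1) (n : ℕ) (A : ℕ → z) :
    Hp z ω n A →ₐ[z] AdjoinRoot (qPoly z n A) :=
  RingQuot.liftAlgHom z ⟨affineChar hr (AdjoinRoot.root _), by
    rintro _ _ ⟨⟩
    rw [affineChar_pKelt, AdjoinRoot.aeval_eq, AdjoinRoot.mk_self, neg_zero, map_zero]⟩

lemma algebraMap_adjoinRoot_ne_zero (n : ℕ) (A : ℕ → z) {ξ : z} (hξ : ξ ≠ 0) :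
    algebraMap z (AdjoinRoot (qPoly z n A)) ξ ≠ 0 := by
  have : Nontrivial z := ⟨ξ, 0, hξ⟩
  have hdeg : (∑ i ∈ Finset.range (n + 1),
      Polynomial.C (A i) * Polynomial.X ^ (n - i)).degree < ((n + 1 : ℕ) : WithBot ℕ) := by
    refine (Polynomial.degree_sum_le _ _).trans_lt ((Finset.sup_lt_iff (WithBot.bot_lt_coe _)).2
      fun i _ => (Polynomial.degree_C_mul_X_pow_le _ _).trans_lt ?_)
    exact_mod_cast Nat.lt_succ_of_le (Nat.sub_le n i)
  have hmonic : (qPoly z n A).Monic := Polynomial.monic_X_pow_sub (by exact_mod_cast hdeg)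
  have hq : (qPoly z n A).degree = ((n + 1 : ℕ) : WithBot ℕ) := by
    rw [qPoly, Polynomial.degree_sub_eq_left_of_degree_lt] <;> rw [Polynomial.degree_X_pow]
    exact hdeg
  intro h
  rw [AdjoinRoot.algebraMap_eq, ← AdjoinRoot.mk_C, AdjoinRoot.mk_eq_zero] at h
  refine hmonic.not_dvd_of_degree_lt (by simpa using hξ) ?_ h
  rw [hq, Polynomial.degree_C hξ]
  exact_mod_cast Nat.succ_pos n

lemma algebraMap_Hp_ne_zero {r : z} (hr : r * r = ω * r + 1) (n : ℕ) (A : ℕ → z) {ξ : z}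
    (hξ : ξ ≠ 0) : algebraMap z (Hp z ω n A) ξ ≠ 0 := fun h =>
  algebraMap_adjoinRoot_ne_zero n A hξ <| by
    rw [← (cyclotomicChar hr n A).commutes, h, map_zero]

lemma tmul_ne_zero_of_ne_zero {F D : Type*} [Field F] [Algebra k F] [AddCommGroup D] [Module k D]
    {f : F} {d : D} (hf : f ≠ 0) (hd : d ≠ 0) : f ⊗ₜ[k] d ≠ 0 := by
  intro h
  refine hd ((Module.FaithfullyFlat.one_tmul_eq_zero_iff k D (A := F) d).1 ?_)
  rw [← inv_mul_cancel₀ hf, ← smul_eq_mul, ← TensorProduct.smul_tmul', h, smul_zero]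

lemma isPrincipal_KxMain {r : z} (hr : r * r = ω * r + 1) (n : ℕ) (hn : 2 ≤ n) (A : ℕ → z)
    {ξ : z} (hξ : ξ ≠ 0) (ζ : z) : IsPrincipal k z ω n A (KxMain k z ω n A ξ ζ) := by
  obtain ⟨n, rfl⟩ : ∃ m, n = m + 1 := ⟨n - 1, by omega⟩
  let f : ℕ → RatFunc k ⊗[k] z := fun m =>
    if m = n + 1 then 1
    else (if m = 0 then constTerm k (n + 1) A ξ ζ else phiT k z (B := z) ξ A (n + 1 - m)) +
      1 ⊗ₜ A (n - m)
  refine .inr ⟨by omega, fun m => scalarMap k (RatFunc k) (f m),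
    fun m => isScalarElt_scalarMap k _, ?_, ?_⟩
  · have h1 : scalarMap k (B := Hp z ω (n + 1) A) (RatFunc k) (f (n + 1)) = 1 := by simp [f]
    beta_reduce
    rw [KxMain_eq, h1, one_mul, Ktil, TensorProduct.tmul_sub, TensorProduct.tmul_sum]
    have h2 (m : ℕ) (hm : m ∈ Finset.range n) :
        scalarMap k (B := Hp z ω (n + 1) A) (RatFunc k) (f (m + 1)) =
          scalarMap k (RatFunc k) (phiT k z (B := z) ξ A (n - m)) +
          1 ⊗ₜ algebraMap z _ (A (n - (m + 1))) := by
      have : m ≠ n := (Finset.mem_range.1 hm).ne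
      simp [f, this]
    have h3 : scalarMap k (B := Hp z ω (n + 1) A) (RatFunc k) (f 0) =
          scalarMap k (RatFunc k) (constTerm k (n + 1) A ξ ζ) + 1 ⊗ₜ algebraMap z _ (A n) := by
      simp [f]
    have h4 : ∑ i ∈ Finset.range (n + 1), (1 : RatFunc k) ⊗ₜ[k]
          (A i • Kp z ω (n + 1) A ^ (n + 1 - 1 - i)) =
        ∑ i ∈ Finset.range (n + 1), (1 : RatFunc k) ⊗ₜ[k]
          (A (n - i) • Kp z ω (n + 1) A ^ i) := by
      rw [← Finset.sum_range_reflect]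
      refine Finset.sum_congr rfl fun i hi => ?_
      have := Finset.mem_range.1 hi
      rw [show n + 1 - 1 - (n + 1 - 1 - i) = i by omega, show n + 1 - 1 - i = n - i by omega]
    have h5 : ∑ i ∈ Finset.range n, scalarMap k (RatFunc k) (phiT k z (B := z) ξ A (i + 1)) *
          (1 : RatFunc k) ⊗ₜ[k] Kp z ω (n + 1) A ^ (n + 1 - (i + 1)) =
        ∑ i ∈ Finset.range n, scalarMap k (RatFunc k) (phiT k z (B := z) ξ A (n - i)) *
          (1 : RatFunc k) ⊗ₜ[k] Kp z ω (n + 1) A ^ (i + 1) := by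
      rw [← Finset.sum_range_reflect]
      refine Finset.sum_congr rfl fun i hi => ?_
      have := Finset.mem_range.1 hi
      rw [show n + 1 - (n - 1 - i + 1) = i + 1 by omega, show n - 1 - i + 1 = n - i by omega]
    rw [h4, Finset.sum_range_succ', h5, Finset.sum_range_succ', Finset.sum_range_succ', h3,
      Finset.sum_congr rfl fun m hm => congrArg (· * _) (h2 m hm)]
    simp only [add_mul, Finset.sum_add_distrib, Algebra.TensorProduct.tmul_pow, one_pow,
      Algebra.TensorProduct.tmul_mul_tmul, one_mul,
      Algebra.smul_def, pow_zero, mul_one, phiT, map_one, Nat.sub_zero]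
    abel
  · have h0 : n ≠ 0 := by omega
    simp only [f, Nat.add_sub_cancel, Nat.sub_self, h0, if_false, show n ≠ n + 1 by omega,
      show n + 1 - n = 1 by omega]
    simpa [phiT] using tmul_ne_zero_of_ne_zero k RatFunc.X_ne_zero
      (algebraMap_Hp_ne_zero hr (n + 1) A hξ)

end Principal

/-- the main theorem. Fix n ≥ 2 and p(u) = −u^{n+1} + A₀uⁿ + ⋯ + Aₙ.
For any ξ, ζ ∈ 𝔷 with ζξ = p(0) = Aₙ, the element
K(x) = Σ_{i=0}^{n−1} φ_i(ξ,x) K^{n−i} + (ζ − x⁻¹φ_n(ξ,x))/(x − x⁻¹) of 𝒦_p(x) solves the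
reflection equation with spectral parameter; moreover it is a principal solution
(its coefficient of K^{n−1} is non-zero when ξ ≠ 0). -/
theorem baxterization_main [CharZero k]
    (q : k) (hq0 : q ≠ 0) (hq1 : q ≠ 1) (hq1' : q ≠ -1)
    (hω : ω = algebraMap k z (q - q⁻¹)) (n : ℕ) (hn : 2 ≤ n) (A : ℕ → z)
    (xi zeta : z) (hzx : zeta * xi = A n) :
    IsSol k (q - q⁻¹) (Rp z ω n A) (KxMain k z ω n A xi zeta) ∧
      (xi ≠ 0 → IsPrincipal k z ω n A (KxMain k z ω n A xi zeta)) := by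
  have hq : algebraMap k z q * algebraMap k z q = ω * algebraMap k z q + 1 := by
    rw [hω, ← map_mul, ← map_mul, ← map_one (algebraMap k z), ← map_add]
    congr 1
    field_simp
    ring
  exact ⟨isSol_KxMain k _ hω n A xi zeta hzx, fun h => isPrincipal_KxMain k hq n hn A h zeta⟩

end Baxterization
end
end

section
/- Let i and j be integers with 0 < i ≤ n and 0 ≤ j ≤ n, and let ξ ∈ 𝔷. Writing φ'_α = φ_α(ξ,x), φ''_α = φ_α(ξ,y) and Δ_α = φ'_α − φ''_α, the following identity holds in 𝔷[x,y]: ξ(x − y) Σ_{α=0}^{i−1} A^{(n+i−α)}_j Σ_{β=0}^{α} φ'_β φ''_{α−β} = Σ_{α=max{j+i−n, 0}}^{i} Δ_α A_{j+i−α}. -/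
noncomputable section
namespace Baxterization
open scoped TensorProduct

/-! ## The affine Hecke algebra of rank one -/

variable (k : Type) [Field k]
variable (z : Type) [CommRing z] [Algebra k z]

variable (ω : z)

variable {B : Type} [Ring B] [Algebra k B]

variable [Algebra z B]

lemma degree_sum_lower_terms_le (n : ℕ) (A : ℕ → z) :
    (∑ i ∈ Finset.range (n + 1), Polynomial.C (A i) * Polynomial.X ^ (n - i)).degree ≤
      (n : WithBot ℕ) := by
  refine (Polynomial.degree_sum_le _ _).trans (Finset.sup_le fun i _ => ?_)
  refine (Polynomial.degree_C_mul_X_pow_le _ _).trans ?_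
  exact_mod_cast Nat.sub_le n i

lemma degree_sum_lower_terms_lt (n : ℕ) (A : ℕ → z) :
    (∑ i ∈ Finset.range (n + 1), Polynomial.C (A i) * Polynomial.X ^ (n - i)).degree <
      ((n + 1 : ℕ) : WithBot ℕ) :=
  (degree_sum_lower_terms_le z n A).trans_lt (WithBot.coe_lt_coe.2 n.lt_succ_self)

lemma qPoly_monic (n : ℕ) (A : ℕ → z) : (qPoly z n A).Monic :=
  Polynomial.monic_X_pow_sub (degree_sum_lower_terms_lt z n A)

lemma Am_of_le (n : ℕ) (A : ℕ → z) {r : ℕ} (hr : r ≤ n) (j : ℕ) :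
    Am z n A r j = if n - j = r then 1 else 0 := by
  nontriviality z
  have hq : (qPoly z n A).degree = ((n + 1 : ℕ) : WithBot ℕ) := by
    rw [qPoly, Polynomial.degree_sub_eq_left_of_degree_lt] <;> rw [Polynomial.degree_X_pow]
    exact degree_sum_lower_terms_lt z n A
  rw [Am, (Polynomial.modByMonic_eq_self_iff (qPoly_monic z n A)).2, Polynomial.coeff_X_pow]
  rw [hq, Polynomial.degree_X_pow]
  exact_mod_cast Nat.lt_succ_of_le hr

/-- The linear recurrence satisfied by the coefficients of the powers of `u` modulo `p(u)`. -/
lemma Am_recurrence (n : ℕ) (A : ℕ → z) (m j : ℕ) :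
    Am z n A (n + 1 + m) j = ∑ s ∈ Finset.range (n + 1), A s * Am z n A (n + m - s) j := by
  have h : (Polynomial.X : Polynomial z) ^ (n + 1 + m) =
      (∑ s ∈ Finset.range (n + 1), A s • (Polynomial.X : Polynomial z) ^ (n + m - s)) +
        qPoly z n A * Polynomial.X ^ m := by
    rw [qPoly, sub_mul, Finset.sum_mul, ← pow_add, add_comm (n + 1) m, ← sub_eq_iff_eq_add', sub_right_inj]
    refine Finset.sum_congr rfl fun s hs => ?_
    have hs' := Finset.mem_range.1 hs
    rw [mul_assoc, ← pow_add, Polynomial.smul_eq_C_mul]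
    congr 2
    omega
  have hz : (qPoly z n A * Polynomial.X ^ m) %ₘ qPoly z n A = 0 :=
    (Polynomial.modByMonic_eq_zero_iff_dvd (qPoly_monic z n A)).2 (dvd_mul_right _ _)
  rw [Am, h, Polynomial.add_modByMonic, hz, add_zero]
  change (Polynomial.modByMonicHom (qPoly z n A) _).coeff (n - j) = _
  rw [map_sum, Polynomial.finsetSum_coeff]
  refine Finset.sum_congr rfl fun s _ => ?_
  rw [map_smul, Polynomial.coeff_smul, smul_eq_mul]
  rfl

lemma Am_sub_sum (n : ℕ) (A : ℕ → z) {m j : ℕ} (hm : m ≤ n) (hj : j ≤ n) :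
    Am z n A (n + 1 + m) j - ∑ s ∈ Finset.range m, A s * Am z n A (n + m - s) j =
      if m + j ≤ n then A (m + j) else 0 := by
  rw [Am_recurrence, ← Finset.sum_range_add_sum_Ico _ (show m ≤ n + 1 by omega), add_sub_cancel_left]
  have h : ∀ s ∈ Finset.Ico m (n + 1), A s * Am z n A (n + m - s) j =
      if s = m + j then A s else 0 := by
    intro s hs
    have hs' := Finset.mem_Ico.1 hs
    rw [Am_of_le z n A (by omega)]
    have : n - j = n + m - s ↔ s = m + j := by omega
    simp [this]
  rw [Finset.sum_congr rfl h, Finset.sum_ite_eq']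
  refine if_congr ?_ rfl rfl
  rw [Finset.mem_Ico]
  omega

/-- The convolution of two sequences satisfying `f (i + 1) = f i * a - c i`, multiplied by the
difference of the two values of `a`. -/
lemma sub_mul_convolution {S : Type*} [CommRing S] (c f g : ℕ → S) (a b : S)
    (hf0 : f 0 = 1) (hg0 : g 0 = 1)
    (hf : ∀ i, f (i + 1) = f i * a - c i) (hg : ∀ i, g (i + 1) = g i * b - c i) (r : ℕ) :
    (a - b) * ∑ β ∈ Finset.range (r + 1), f β * g (r - β) =
      (f (r + 1) - g (r + 1)) -
        ∑ β ∈ Finset.range (r + 1), c (r - β) * (f β - g β) := by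
  have ha : a * ∑ β ∈ Finset.range (r + 1), f β * g (r - β) =
      ∑ β ∈ Finset.range (r + 1), f (β + 1) * g (r - β) +
        ∑ β ∈ Finset.range (r + 1), c (r - β) * g β := by
    rw [← Finset.sum_range_reflect (fun β => c (r - β) * g β), Finset.mul_sum,
      ← Finset.sum_add_distrib]
    refine Finset.sum_congr rfl fun β hβ => ?_
    have := Finset.mem_range.1 hβ
    rw [hf, show r + 1 - 1 - β = r - β by omega, show r - (r - β) = β by omega]
    ring
  have hb : b * ∑ β ∈ Finset.range (r + 1), f β * g (r - β) =
      ∑ β ∈ Finset.range (r + 1), f β * g (r + 1 - β) +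
        ∑ β ∈ Finset.range (r + 1), c (r - β) * f β := by
    rw [Finset.mul_sum, ← Finset.sum_add_distrib]
    refine Finset.sum_congr rfl fun β hβ => ?_
    have := Finset.mem_range.1 hβ
    rw [show r + 1 - β = r - β + 1 by omega, hg]
    ring
  have ht : f (r + 1) + ∑ β ∈ Finset.range (r + 1), f β * g (r + 1 - β) =
      ∑ β ∈ Finset.range (r + 1), f (β + 1) * g (r - β) + g (r + 1) := by
    have h1 := Finset.sum_range_succ (fun β => f β * g (r + 1 - β)) (r + 1)
    have h2 := Finset.sum_range_succ' (fun β => f β * g (r + 1 - β)) (r + 1)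
    simp only [Nat.add_sub_add_right, Nat.sub_self, Nat.sub_zero, hf0, hg0, mul_one, one_mul]
      at h1 h2
    linear_combination h2 - h1
  simp only [mul_sub, Finset.sum_sub_distrib]
  linear_combination ha - hb - ht

/-- Summation by parts: collecting the coefficients of `d γ`. -/
lemma sum_mul_sub_convolution {S : Type*} [CommRing S] (B c d : ℕ → S) (hd : d 0 = 0) (i : ℕ) :
    ∑ α ∈ Finset.range i, B (i - α) *
        (d (α + 1) - ∑ β ∈ Finset.range (α + 1), c (α - β) * d β) =
      ∑ γ ∈ Finset.range (i + 1), d γ *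
        (B (1 + (i - γ)) - ∑ s ∈ Finset.range (i - γ), c s * B (i - γ - s)) := by
  have h1 : ∑ α ∈ Finset.range i, B (i - α) * d (α + 1) =
      ∑ γ ∈ Finset.range (i + 1), d γ * B (1 + (i - γ)) := by
    rw [Finset.sum_range_succ', hd, zero_mul, add_zero]
    refine Finset.sum_congr rfl fun α hα => ?_
    have := Finset.mem_range.1 hα
    rw [show 1 + (i - (α + 1)) = i - α by omega, mul_comm]
  have h2 : ∑ α ∈ Finset.range i, B (i - α) * ∑ β ∈ Finset.range (α + 1), c (α - β) * d β =
      ∑ γ ∈ Finset.range (i + 1), d γ * ∑ s ∈ Finset.range (i - γ), c s * B (i - γ - s) := by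
    simp only [Finset.sum_range_succ _ i, Nat.sub_self, Finset.range_zero, Finset.sum_empty,
      mul_zero, add_zero]
    simp only [Finset.mul_sum]
    rw [Finset.sum_comm' (t' := Finset.range i) (s' := fun β => Finset.Ico β i)
      (by intro α β; simp only [Finset.mem_range, Finset.mem_Ico]; omega)]
    refine Finset.sum_congr rfl fun β _ => ?_
    rw [Finset.sum_Ico_eq_sum_range]
    refine Finset.sum_congr rfl fun s _ => ?_
    rw [Nat.add_sub_cancel_left, Nat.sub_sub]
    ring
  simp only [mul_sub, Finset.sum_sub_distrib] at h1 h2 ⊢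
  rw [h1, h2]

lemma evP_phiP_succ (A : ℕ → z) (xi : z) (v : Fin 2) (i : ℕ) :
    evP z v (phiP z A xi (i + 1)) =
      evP z v (phiP z A xi i) * (MvPolynomial.C xi * MvPolynomial.X v) - MvPolynomial.C (A i) := by
  simp [phiP, evP, MvPolynomial.algebraMap_eq]

/-- For 0 < i ≤ n, 0 ≤ j ≤ n and ξ ∈ 𝔷, in 𝔷[x,y]:
ξ(x − y) Σ_{α=0}^{i−1} A^{(n+i−α)}_j Σ_{β=0}^{α} φ'_β φ''_{α−β}
  = Σ_{α=max(j+i−n,0)}^{i} Δ_α A_{j+i−α}. -/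
theorem Am_phi_summation_identity [CharZero k]
    (n : ℕ) (hn : 1 ≤ n) (A : ℕ → z) (xi : z) (i j : ℕ)
    (hi0 : 0 < i) (hin : i ≤ n) (hjn : j ≤ n) :
    MvPolynomial.C xi * (MvPolynomial.X 0 - MvPolynomial.X 1) *
        ∑ α ∈ Finset.range i, MvPolynomial.C (Am z n A (n + i - α) j) *
          ∑ β ∈ Finset.range (α + 1),
            evP z 0 (phiP z A xi β) * evP z 1 (phiP z A xi (α - β)) =
      ∑ α ∈ Finset.Icc (j + i - n) i,
        (evP z 0 (phiP z A xi α) - evP z 1 (phiP z A xi α)) *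
          MvPolynomial.C (A (j + i - α)) := by
  rw [mul_sub, Finset.mul_sum]
  have hconv := sub_mul_convolution (fun r => MvPolynomial.C (A r))
    (fun r => evP z 0 (phiP z A xi r)) (fun r => evP z 1 (phiP z A xi r)) _ _
    (by simp [phiP]) (by simp [phiP]) (evP_phiP_succ z A xi 0) (evP_phiP_succ z A xi 1)
  have hsum := sum_mul_sub_convolution (fun m => MvPolynomial.C (Am z n A (n + m) j))
    (fun r => MvPolynomial.C (A r))
    (fun r => evP z 0 (phiP z A xi r) - evP z 1 (phiP z A xi r)) (by simp [phiP]) i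
  calc _ = _ := Finset.sum_congr rfl fun α hα => ?_
    _ = _ := hsum
    _ = ∑ γ ∈ Finset.range (i + 1), if i - γ + j ≤ n then
        (evP z 0 (phiP z A xi γ) - evP z 1 (phiP z A xi γ)) *
          MvPolynomial.C (A (j + i - γ)) else 0 := Finset.sum_congr rfl fun γ hγ => ?_
    _ = _ := ?_
  · have := Finset.mem_range.1 hα
    rw [mul_left_comm, hconv, Nat.add_sub_assoc this.le]
  · have := Finset.mem_range.1 hγ
    have h := congrArg (MvPolynomial.C (σ := Fin 2)) (Am_sub_sum z n A (m := i - γ) (by omega) hjn)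
    rw [map_sub, map_sum] at h
    simp only [map_mul] at h
    have hs : ∀ s ∈ Finset.range (i - γ), n + (i - γ) - s = n + (i - γ - s) := by
      intro s hs
      have := Finset.mem_range.1 hs
      omega
    rw [Finset.sum_congr rfl fun s hs' => by rw [hs s hs'], add_assoc] at h
    rw [h, show i - γ + j = j + i - γ by omega]
    split_ifs <;> simp
  · rw [← Finset.sum_filter]
    refine Finset.sum_congr ?_ fun _ _ => rfl
    ext γ
    simp only [Finset.mem_filter, Finset.mem_range, Finset.mem_Icc]
    omega

end Baxterization
end
end
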